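/- The class of parsing expression languages is closed under left concatenation with the regular closure of the DCFLs, and equals the class of such products: for every X ∈ Γ_REG(DCFL) and every PEL Y, the concatenation XY is a PEL; conversely, every PEL Y equals XY for some X ∈ Γ_REG(DCFL) (e.g., X = {ε}). Hence Γ_REG(DCFL) · PEL = PEL. -/

import Mathlib

/-! ### Parsing expression grammars -/

/-- Parsing expressions over nonterminals `N` and input alphabet `A`:
`ε`, terminals, nonterminals, sequence, prioritized choice, not-predicate. -/
inductive PExp (N A : Type) : Type where
  | eps : PExp N A
  | term : A → PExp N A
  | nt : N → PExp N A
  | seq : PExp N A → PExp N A → PExp N A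
  | choice : PExp N A → PExp N A → PExp N A
  | not : PExp N A → PExp N A

/-- A parsing expression grammar: one rule per nonterminal, and an axiom. -/
structure PEG (N A : Type) : Type where
  rule : N → PExp N A
  start : N

/-- Big-step relational semantics of the PEG parsing function `R`:
`Parses G e w r` means `R(e, w) = r`, where `r = none` encodes the failure `F`
and `r = some s` means that `e` consumed a prefix of `w` leaving the suffix `s`.
`R(e, w)` is defined iff `∃ r, Parses G e w r`. -/
inductive Parses {N A : Type} (G : PEG N A) : PExp N A → List A → Option (List A) → Prop where
  | eps (w : List A) : Parses G .eps w (some w)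
  | term_ok (a : A) (s : List A) : Parses G (.term a) (a :: s) (some s)
  | term_mismatch {a b : A} (s : List A) (h : a ≠ b) : Parses G (.term a) (b :: s) none
  | term_nil (a : A) : Parses G (.term a) [] none
  | nt {B : N} {w : List A} {r : Option (List A)} :
      Parses G (G.rule B) w r → Parses G (.nt B) w r
  | seq_ok {e₁ e₂ : PExp N A} {w w' : List A} {r : Option (List A)} :
      Parses G e₁ w (some w') → Parses G e₂ w' r → Parses G (.seq e₁ e₂) w r
  | seq_fail {e₁ e₂ : PExp N A} {w : List A} :
      Parses G e₁ w none → Parses G (.seq e₁ e₂) w none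
  | choice_fst {e₁ e₂ : PExp N A} {w w' : List A} :
      Parses G e₁ w (some w') → Parses G (.choice e₁ e₂) w (some w')
  | choice_snd {e₁ e₂ : PExp N A} {w : List A} {r : Option (List A)} :
      Parses G e₁ w none → Parses G e₂ w r → Parses G (.choice e₁ e₂) w r
  | not_succ {e : PExp N A} {w : List A} :
      Parses G e w none → Parses G (.not e) w (some w)
  | not_fail {e : PExp N A} {w w' : List A} :
      Parses G e w (some w') → Parses G (.not e) w none

/-- The language generated by a PEG: `L(G) = {w | R(S, w) = ε}`. -/
def PEG.Lang {N A : Type} (G : PEG N A) : Set (List A) :=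
  {w | Parses G (.nt G.start) w (some [])}

/-- A PEG is complete if `R(S, w)` is defined for every input `w`. -/
def PEG.Complete {N A : Type} (G : PEG N A) : Prop :=
  ∀ w : List A, ∃ r, Parses G (.nt G.start) w r

/-- Conservative test whether an expression could succeed without consuming input. -/
def PExp.maybeEmpty {N A : Type} : PExp N A → Bool
  | .eps => true
  | .term _ => false
  | .nt _ => true
  | .seq e₁ e₂ => e₁.maybeEmpty && e₂.maybeEmpty
  | .choice e₁ e₂ => e₁.maybeEmpty || e₂.maybeEmpty
  | .not _ => true

/-- The nonterminals that an expression can invoke without first consuming input. -/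
def PExp.leftNts {N A : Type} : PExp N A → Set N
  | .eps => ∅
  | .term _ => ∅
  | .nt B => {B}
  | .seq e₁ e₂ => e₁.leftNts ∪ (if e₁.maybeEmpty then e₂.leftNts else ∅)
  | .choice e₁ e₂ => e₁.leftNts ∪ e₂.leftNts
  | .not e => e.leftNts

/-- A PEG is well-formed if it has no (directly or mutually) left-recursive rules:
no nonterminal can reach an invocation of itself without consuming input. -/
def PEG.WellFormed {N A : Type} (G : PEG N A) : Prop :=
  ∀ B : N, ¬ Relation.TransGen (fun X Y : N => Y ∈ (G.rule X).leftNts) B B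

/-- A language is a parsing expression language (PEL) if it is generated by some
well-formed PEG with a finite set of nonterminals. -/
def IsPEL {A : Type} (L : Set (List A)) : Prop :=
  ∃ (N : Type) (_ : Finite N) (G : PEG N A), G.WellFormed ∧ G.Lang = L

/-! ### Standard deterministic pushdown automata -/

/-- A standard one-way deterministic pushdown automaton accepting by final state,
with reading transitions `transA` and ε-transitions `transE`; determinism requires
that no ε-move is available whenever a reading move is. -/
structure DPDA (Q A Γ : Type) : Type where
  transA : Q → A → Γ → Option (Q × List Γ)
  transE : Q → Γ → Option (Q × List Γ)
  det : ∀ q Z, transE q Z ≠ none → ∀ a, transA q a Z = none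
  init : Q
  Z0 : Γ
  final : Q → Bool

/-- One move of a DPDA on configurations `(state, stack, remaining input)`. -/
inductive DPDA.Step {Q A Γ : Type} (M : DPDA Q A Γ) :
    Q × List Γ × List A → Q × List Γ × List A → Prop where
  | readA {q : Q} {a : A} {Z : Γ} {γ : List Γ} {u : List A} {p : Q} {β : List Γ} :
      M.transA q a Z = some (p, β) → DPDA.Step M (q, Z :: γ, a :: u) (p, β ++ γ, u)
  | readE {q : Q} {Z : Γ} {γ : List Γ} {u : List A} {p : Q} {β : List Γ} :
      M.transE q Z = some (p, β) → DPDA.Step M (q, Z :: γ, u) (p, β ++ γ, u)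

/-- The language of a DPDA: words after whose consumption a final state is reached. -/
def DPDA.Lang {Q A Γ : Type} (M : DPDA Q A Γ) : Set (List A) :=
  {w | ∃ (p : Q) (γ : List Γ),
    Relation.ReflTransGen (DPDA.Step M) (M.init, [M.Z0], w) (p, γ, []) ∧ M.final p = true}

/-- A language is a DCFL if it is recognized by some DPDA with finitely many
states and stack symbols. -/
def IsDCFL {A : Type} (L : Set (List A)) : Prop :=
  ∃ (Q Γ : Type) (_ : Finite Q) (_ : Finite Γ) (M : DPDA Q A Γ), M.Lang = L

/-- Concatenation of languages: `XY = {xy | x ∈ X, y ∈ Y}`. -/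
def concatL {A : Type} (X Y : Set (List A)) : Set (List A) :=
  {w | ∃ x ∈ X, ∃ y ∈ Y, w = x ++ y}

/-- Kleene star of a language: all concatenations of finitely many words of `X`. -/
def kstarL {A : Type} (X : Set (List A)) : Set (List A) :=
  {w | ∃ l : List (List A), (∀ u ∈ l, u ∈ X) ∧ w = l.flatten}

/-- The regular closure of the DCFLs: the smallest class of languages containing
all DCFLs and closed under union, concatenation and Kleene star. -/
inductive RegClosureDCFL {A : Type} : Set (List A) → Prop where
  | dcfl {L : Set (List A)} : IsDCFL L → RegClosureDCFL L
  | union {L₁ L₂ : Set (List A)} :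
      RegClosureDCFL L₁ → RegClosureDCFL L₂ → RegClosureDCFL (L₁ ∪ L₂)
  | concat {L₁ L₂ : Set (List A)} :
      RegClosureDCFL L₁ → RegClosureDCFL L₂ → RegClosureDCFL (concatL L₁ L₂)
  | star {L : Set (List A)} : RegClosureDCFL L → RegClosureDCFL (kstarL L)


/-! ### Denotational evaluation of parsing expressions -/

section Eval

open Classical in
/-- Evaluate a parsing expression given an interpretation of the nonterminals. -/
noncomputable def denote {N A : Type} (f : N → List A → Option (List A)) :
    PExp N A → List A → Option (List A)
  | .eps, w => some w
  | .term _, [] => none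
  | .term a, b :: s => if a = b then some s else none
  | .nt B, w => f B w
  | .seq e₁ e₂, w => (denote f e₁ w).bind (denote f e₂)
  | .choice e₁ e₂, w => match denote f e₁ w with
    | some u => some u
    | none => denote f e₂ w
  | .not e, w => match denote f e w with
    | some _ => none
    | none => some w

theorem denote_of_parses {N A : Type} {G : PEG N A} {f : N → List A → Option (List A)}
    (hf : ∀ B w, f B w = denote f (G.rule B) w) {e : PExp N A} {w : List A} {r : Option (List A)}
    (h : Parses G e w r) : denote f e w = r := by
  induction h with
  | eps w => simp [denote]
  | term_ok a s => simp [denote]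
  | term_mismatch s h => simp [denote, h]
  | term_nil a => simp [denote]
  | nt _ ih => simp only [denote]; rw [hf, ih]
  | seq_ok _ _ ih1 ih2 => simp [denote, ih1, ih2]
  | seq_fail _ ih => simp [denote, ih]
  | choice_fst _ ih => simp [denote, ih]
  | choice_snd _ _ ih1 ih2 => simp [denote, ih1, ih2]
  | not_succ _ ih => simp [denote, ih]
  | not_fail _ ih => simp [denote, ih]

theorem parses_length {N A : Type} {G : PEG N A} {e : PExp N A} {w : List A}
    {r : Option (List A)} (h : Parses G e w r) :
    ∀ u, r = some u → u.length ≤ w.length ∧ (e.maybeEmpty = false → u.length < w.length) := by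
  induction h with
  | eps w => rintro u ⟨⟩; simp [PExp.maybeEmpty]
  | term_ok a s => rintro u ⟨⟩; simp
  | term_mismatch s h => simp
  | term_nil a => simp
  | nt _ ih => intro u hu; simp [PExp.maybeEmpty, (ih u hu).1]
  | seq_ok _ _ ih1 ih2 =>
    intro u hu
    have h1 := ih1 _ rfl
    have h2 := ih2 _ hu
    refine ⟨by omega, ?_⟩
    simp only [PExp.maybeEmpty, Bool.and_eq_false_iff]
    rintro (h | h)
    · have := h1.2 h; omega
    · have := h2.2 h; omega
  | seq_fail _ ih => simp
  | choice_fst _ ih =>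
    rintro u ⟨⟩
    have h1 := ih _ rfl
    refine ⟨h1.1, ?_⟩
    simp only [PExp.maybeEmpty, Bool.or_eq_false_iff]
    exact fun h => h1.2 h.1
  | choice_snd _ _ ih1 ih2 =>
    intro u hu
    have h1 := ih2 _ hu
    refine ⟨h1.1, ?_⟩
    simp only [PExp.maybeEmpty, Bool.or_eq_false_iff]
    exact fun h => h1.2 h.2
  | not_succ _ ih => rintro u ⟨⟩; simp [PExp.maybeEmpty]
  | not_fail _ ih => simp

theorem parses_total {N A : Type} [Finite N] {G : PEG N A} (rank : N → ℕ)
    (hr : ∀ B C, C ∈ (G.rule B).leftNts → rank C < rank B) (e : PExp N A) (w : List A) :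
    ∃ r, Parses G e w r := by
  have key : ∀ n : ℕ, ∀ e : PExp N A, ∀ w : List A, w.length = n → ∃ r, Parses G e w r := by
    intro n
    induction n using Nat.strong_induction_on with
    | _ n ihn =>
    have inner : ∀ r : ℕ, ∀ e : PExp N A, (∀ B ∈ e.leftNts, rank B < r) →
        ∀ w : List A, w.length = n → ∃ r, Parses G e w r := by
      intro r
      induction r using Nat.strong_induction_on with
      | _ r ihr =>
      intro e
      induction e with
      | eps => intro _ w _; exact ⟨_, .eps w⟩
      | term a =>
        intro _ w _
        cases w with
        | nil => exact ⟨_, .term_nil a⟩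
        | cons b s =>
          by_cases h : a = b
          · subst h; exact ⟨_, .term_ok a s⟩
          · exact ⟨_, .term_mismatch s h⟩
      | nt B =>
        intro hB w hw
        obtain ⟨x, hx⟩ := ihr (rank B) (hB B (by simp [PExp.leftNts])) (G.rule B) (hr B) w hw
        exact ⟨x, .nt hx⟩
      | seq e₁ e₂ ih1 ih2 =>
        intro hB w hw
        obtain ⟨x, hx⟩ := ih1 (fun B h => hB B (by simp [PExp.leftNts, h])) w hw
        cases x with
        | none => exact ⟨_, .seq_fail hx⟩
        | some u =>
          have hl := parses_length hx u rfl
          have : ∃ y, Parses G e₂ u y := by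
            by_cases hlt : u.length < n
            · exact ihn _ hlt e₂ u rfl
            · have hm : e₁.maybeEmpty = true := by
                by_contra hc
                have := hl.2 (by simpa using hc)
                omega
              exact ih2 (fun B h => hB B (by simp [PExp.leftNts, h, hm])) u (by omega)
          obtain ⟨y, hy⟩ := this
          exact ⟨y, .seq_ok hx hy⟩
      | choice e₁ e₂ ih1 ih2 =>
        intro hB w hw
        obtain ⟨x, hx⟩ := ih1 (fun B h => hB B (by simp [PExp.leftNts, h])) w hw
        obtain ⟨y, hy⟩ := ih2 (fun B h => hB B (by simp [PExp.leftNts, h])) w hw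
        cases x with
        | none => exact ⟨_, .choice_snd hx hy⟩
        | some u => exact ⟨_, .choice_fst hx⟩
      | not e ih =>
        intro hB w hw
        obtain ⟨x, hx⟩ := ih (fun B h => hB B (by simpa [PExp.leftNts] using h)) w hw
        cases x with
        | none => exact ⟨_, .not_succ hx⟩
        | some u => exact ⟨_, .not_fail hx⟩
    intro e w hw
    obtain ⟨b, hb⟩ := (Set.finite_range rank).bddAbove
    exact inner (b + 1) e (fun B _ => Nat.lt_succ_of_le (hb ⟨B, rfl⟩)) w hw
  exact key _ e w rfl

theorem parses_iff {N A : Type} [Finite N] {G : PEG N A} (rank : N → ℕ)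
    (hr : ∀ B C, C ∈ (G.rule B).leftNts → rank C < rank B)
    {f : N → List A → Option (List A)}
    (hf : ∀ B w, f B w = denote f (G.rule B) w) (e : PExp N A) (w : List A)
    (r : Option (List A)) : Parses G e w r ↔ denote f e w = r := by
  refine ⟨denote_of_parses hf, fun h => ?_⟩
  obtain ⟨r', hr'⟩ := parses_total rank hr e w
  have := denote_of_parses hf hr'
  rw [h] at this
  rw [this]; exact hr'

theorem wellFormed_of_rank {N A : Type} {G : PEG N A} (rank : N → ℕ)
    (hr : ∀ B C, C ∈ (G.rule B).leftNts → rank C < rank B) : G.WellFormed := by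
  have : ∀ B C, Relation.TransGen (fun X Y : N => Y ∈ (G.rule X).leftNts) B C →
      rank C < rank B := by
    intro B C h
    induction h with
    | single h => exact hr _ _ h
    | tail _ h ih => exact lt_trans (hr _ _ h) ih
  exact fun B h => lt_irrefl _ (this B B h)

theorem rank_of_wellFormed {N A : Type} [Finite N] {G : PEG N A} (h : G.WellFormed) :
    ∃ rank : N → ℕ, ∀ B C, C ∈ (G.rule B).leftNts → rank C < rank B := by
  refine ⟨fun B => Set.ncard {C | Relation.TransGen (fun X Y : N => Y ∈ (G.rule X).leftNts) B C},
    fun B C hC => ?_⟩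
  refine Set.ncard_lt_ncard ⟨fun D hD => Relation.TransGen.head hC hD, fun hs => ?_⟩
    (Set.toFinite _)
  exact h C (hs (Relation.TransGen.single hC))

/-- A fixpoint interpretation of a well-formed grammar. -/
theorem exists_interp {N A : Type} [Finite N] {G : PEG N A} (rank : N → ℕ)
    (hr : ∀ B C, C ∈ (G.rule B).leftNts → rank C < rank B) :
    ∃ f : N → List A → Option (List A), ∀ B w, f B w = denote f (G.rule B) w := by
  choose g hg using parses_total (G := G) rank hr
  have det : ∀ {e : PExp N A} {w : List A} {r : Option (List A)}, Parses G e w r →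
      denote (fun B w => g (.nt B) w) e w = r := by
    intro e w r h
    have uniq : ∀ {e : PExp N A} {w : List A} {r : Option (List A)}, Parses G e w r →
        ∀ r', Parses G e w r' → r = r' := by
      intro e w r h
      induction h with
      | eps w => rintro r' ⟨⟩; rfl
      | term_ok a s =>
        intro r' h'; cases h' with
        | term_ok => rfl
        | term_mismatch _ h => exact absurd rfl h
      | term_mismatch s h =>
        intro r' h'; cases h' with
        | term_ok => exact absurd rfl h
        | term_mismatch => rfl
      | term_nil a => rintro r' ⟨⟩; rfl
      | nt _ ih => intro r' h'; cases h' with | nt h => exact ih _ h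
      | seq_ok _ _ ih1 ih2 =>
        intro r' h'; cases h' with
        | seq_ok h1 h2 => cases ih1 _ h1; exact ih2 _ h2
        | seq_fail h => cases ih1 _ h
      | seq_fail _ ih =>
        intro r' h'; cases h' with
        | seq_ok h1 h2 => cases ih _ h1
        | seq_fail h => rfl
      | choice_fst _ ih =>
        intro r' h'; cases h' with
        | choice_fst h => exact ih _ h
        | choice_snd h1 h2 => cases ih _ h1
      | choice_snd _ _ ih1 ih2 =>
        intro r' h'; cases h' with
        | choice_fst h => cases ih1 _ h
        | choice_snd h1 h2 => exact ih2 _ h2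
      | not_succ _ ih =>
        intro r' h'; cases h' with
        | not_succ h => rfl
        | not_fail h => cases ih _ h
      | not_fail _ ih =>
        intro r' h'; cases h' with
        | not_succ h => cases ih _ h
        | not_fail h => rfl
    induction h with
    | eps w => simp [denote]
    | term_ok a s => simp [denote]
    | term_mismatch s h => simp [denote, h]
    | term_nil a => simp [denote]
    | nt h ih => simp only [denote]; exact uniq (hg _ _) _ (.nt h)
    | seq_ok _ _ ih1 ih2 => simp [denote, ih1, ih2]
    | seq_fail _ ih => simp [denote, ih]
    | choice_fst _ ih => simp [denote, ih]
    | choice_snd _ _ ih1 ih2 => simp [denote, ih1, ih2]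
    | not_succ _ ih => simp [denote, ih]
    | not_fail _ ih => simp [denote, ih]
  refine ⟨fun B w => g (.nt B) w, fun B w => ?_⟩
  have := hg (.nt B) w
  cases h' : this with
  | nt h => exact (det h).symm

/-- Renaming of nonterminals. -/
def PExp.rename {N M A : Type} (σ : N → M) : PExp N A → PExp M A
  | .eps => .eps
  | .term a => .term a
  | .nt B => .nt (σ B)
  | .seq e₁ e₂ => .seq (e₁.rename σ) (e₂.rename σ)
  | .choice e₁ e₂ => .choice (e₁.rename σ) (e₂.rename σ)
  | .not e => .not (e.rename σ)

theorem denote_rename {N M A : Type} (σ : N → M) (g : M → List A → Option (List A))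
    (e : PExp N A) (w : List A) : denote g (e.rename σ) w = denote (fun B => g (σ B)) e w := by
  induction e generalizing w with
  | eps => simp [denote, PExp.rename]
  | term a => cases w <;> simp [denote, PExp.rename]
  | nt B => simp [denote, PExp.rename]
  | seq e₁ e₂ ih1 ih2 =>
    simp only [denote, PExp.rename, ih1]
    congr 1; funext u; exact ih2 u
  | choice e₁ e₂ ih1 ih2 => simp [denote, PExp.rename, ih1, ih2]
  | not e ih => simp [denote, PExp.rename, ih]

theorem maybeEmpty_rename {N M A : Type} (σ : N → M) (e : PExp N A) :
    (e.rename σ).maybeEmpty = e.maybeEmpty := by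
  induction e <;> simp_all [PExp.rename, PExp.maybeEmpty]

theorem leftNts_rename {N M A : Type} (σ : N → M) (e : PExp N A) :
    (e.rename σ).leftNts = σ '' e.leftNts := by
  induction e with
  | eps => simp [PExp.rename, PExp.leftNts]
  | term a => simp [PExp.rename, PExp.leftNts]
  | nt B => simp [PExp.rename, PExp.leftNts]
  | seq e₁ e₂ ih1 ih2 =>
    simp only [PExp.rename, PExp.leftNts, maybeEmpty_rename, ih1, ih2, Set.image_union]
    split <;> simp
  | choice e₁ e₂ ih1 ih2 => simp [PExp.rename, PExp.leftNts, ih1, ih2, Set.image_union]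
  | not e ih => simp [PExp.rename, PExp.leftNts, ih]

/-- The failing expression. -/
def PExp.fail {N A : Type} : PExp N A := .not .eps

/-- Iterated prioritized choice. -/
def PExp.big {N A ι : Type} (g : ι → PExp N A) : List ι → PExp N A
  | [] => .fail
  | i :: l => .choice (g i) (PExp.big g l)

@[simp] theorem denote_fail {N A : Type} (f : N → List A → Option (List A)) (w : List A) :
    denote f PExp.fail w = none := by simp [PExp.fail, denote]

@[simp] theorem leftNts_fail {N A : Type} : (PExp.fail : PExp N A).leftNts = ∅ := rfl

theorem denote_choice_some {N A : Type} (f : N → List A → Option (List A)) (e₁ e₂ : PExp N A)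
    (w u : List A)
    (h : ∀ u v, denote f e₁ w = some u → denote f e₂ w = some v → u = v) :
    denote f (.choice e₁ e₂) w = some u ↔ denote f e₁ w = some u ∨ denote f e₂ w = some u := by
  simp only [denote]
  cases h1 : denote f e₁ w with
  | none => simp
  | some v =>
    simp only [Option.some.injEq]
    refine ⟨Or.inl, ?_⟩
    rintro (h' | h')
    · exact h'
    · exact h v u h1 h'

theorem denote_big_some {N A ι : Type} (f : N → List A → Option (List A)) (g : ι → PExp N A)
    (l : List ι) (w u : List A)
    (h : ∀ i j u v, denote f (g i) w = some u → denote f (g j) w = some v → u = v) :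
    denote f (PExp.big g l) w = some u ↔ ∃ i ∈ l, denote f (g i) w = some u := by
  induction l generalizing u with
  | nil => simp [PExp.big]
  | cons i l ih =>
    rw [PExp.big, denote_choice_some]
    · rw [ih]; simp
    · intro a b ha hb
      obtain ⟨j, _, hj⟩ := (ih b).1 hb
      exact h i j a b ha hj

theorem leftNts_big {N A ι : Type} (g : ι → PExp N A) (l : List ι) (h : ∀ i, (g i).leftNts = ∅) :
    (PExp.big g l).leftNts = ∅ := by
  induction l with
  | nil => rfl
  | cons i l ih => simp [PExp.big, PExp.leftNts, h, ih]

theorem denote_seq_some {N A : Type} (f : N → List A → Option (List A)) (e₁ e₂ : PExp N A)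
    (w u : List A) : denote f (.seq e₁ e₂) w = some u ↔
      ∃ v, denote f e₁ w = some v ∧ denote f e₂ v = some u := by
  simp [denote, Option.bind_eq_some_iff]

theorem denote_term_some {N A : Type} (f : N → List A → Option (List A)) (a : A)
    (w u : List A) : denote f (.term a) w = some u ↔ w = a :: u := by
  cases w with
  | nil => simp [denote]
  | cons b s =>
    simp only [denote, Option.ite_none_right_eq_some, Option.some.injEq, List.cons.injEq]
    constructor <;> rintro ⟨rfl, rfl⟩ <;> simp

open Classical in
/-- The matcher of a language: consumes everything or fails. -/
noncomputable def matcher {A : Type} (K : Set (List A)) (w : List A) : Option (List A) :=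
  if w ∈ K then some [] else none

theorem matcher_some {A : Type} (K : Set (List A)) (w u : List A) :
    matcher K w = some u ↔ w ∈ K ∧ u = [] := by
  unfold matcher; split <;> simp_all [eq_comm]

/-- Interpretation of an open grammar, where `none` is the continuation. -/
noncomputable def extI {N A : Type} (f : N → List A → Option (List A)) (K : Set (List A)) :
    Option N → List A → Option (List A)
  | none => matcher K
  | some B => f B

/-- Open-grammar representability of left concatenation by the nonempty words of `X`. -/
def Good {A : Type} (X : Set (List A)) : Prop :=
  ∃ (N : Type) (_ : Finite N) (rule : N → PExp (Option N) A) (e : PExp (Option N) A)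
    (rank : N → ℕ), e.leftNts = ∅ ∧
    (∀ B C, some C ∈ (rule B).leftNts → rank C < rank B) ∧
    ∀ K : Set (List A), ∃ f : N → List A → Option (List A),
      (∀ B w, f B w = denote (extI f K) (rule B) w) ∧
      ∀ w, denote (extI f K) e w = matcher (concatL (X \ {[]}) K) w

theorem choice_matcher {N A : Type} (f : N → List A → Option (List A)) (e₁ e₂ : PExp N A)
    (K₁ K₂ : Set (List A)) (w : List A)
    (h1 : denote f e₁ w = matcher K₁ w) (h2 : denote f e₂ w = matcher K₂ w) :
    denote f (.choice e₁ e₂) w = matcher (K₁ ∪ K₂) w := by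
  apply Option.ext
  intro u
  rw [denote_choice_some, h1, h2]
  · simp only [matcher_some, Set.mem_union]; tauto
  · intro u v hu hv
    rw [h1, matcher_some] at hu
    rw [h2, matcher_some] at hv
    rw [hu.2, hv.2]

open Classical in
/-- Guarded expression. -/
noncomputable def PExp.onlyIf {N A : Type} (p : Prop) (e : PExp N A) : PExp N A :=
  if p then e else .fail

theorem onlyIf_matcher {N A : Type} (f : N → List A → Option (List A)) (p : Prop) (e : PExp N A)
    (K : Set (List A)) (w : List A) (h : denote f e w = matcher K w) :
    denote f (.onlyIf p e) w = matcher {w | p ∧ w ∈ K} w := by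
  unfold PExp.onlyIf matcher
  split <;> rename_i hp
  · rw [h]; unfold matcher; congr 1; simp [hp]
  · simp [hp]

theorem leftNts_onlyIf {N A : Type} (p : Prop) (e : PExp N A) :
    (PExp.onlyIf p e).leftNts ⊆ e.leftNts := by
  unfold PExp.onlyIf; split <;> simp

theorem good_union {A : Type} {X Y : Set (List A)} (hX : Good X) (hY : Good Y) :
    Good (X ∪ Y) := by
  obtain ⟨N₁, _, rule₁, e₁, rank₁, he₁, hr₁, h₁⟩ := hX
  obtain ⟨N₂, _, rule₂, e₂, rank₂, he₂, hr₂, h₂⟩ := hY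
  let σ₁ : Option N₁ → Option (N₁ ⊕ N₂) := Option.map Sum.inl
  let σ₂ : Option N₂ → Option (N₁ ⊕ N₂) := Option.map Sum.inr
  refine ⟨N₁ ⊕ N₂, inferInstance,
    Sum.elim (fun B => (rule₁ B).rename σ₁) (fun B => (rule₂ B).rename σ₂),
    .choice (e₁.rename σ₁) (e₂.rename σ₂), Sum.elim rank₁ rank₂, ?_, ?_, ?_⟩
  · simp [PExp.leftNts, leftNts_rename, he₁, he₂]
  · rintro (B | B) C hC
    · simp only [Sum.elim_inl, leftNts_rename] at hC
      obtain ⟨_ | D, hD, hDC⟩ := hC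
      · simp [σ₁] at hDC
      · simp only [σ₁, Option.map_some, Option.some.injEq] at hDC
        subst hDC; exact hr₁ _ _ hD
    · simp only [Sum.elim_inr, leftNts_rename] at hC
      obtain ⟨_ | D, hD, hDC⟩ := hC
      · simp [σ₂] at hDC
      · simp only [σ₂, Option.map_some, Option.some.injEq] at hDC
        subst hDC; exact hr₂ _ _ hD
  · intro K
    obtain ⟨f₁, hf₁, hK₁⟩ := h₁ K
    obtain ⟨f₂, hf₂, hK₂⟩ := h₂ K
    have c₁ : (fun B => extI (Sum.elim f₁ f₂) K (σ₁ B)) = extI f₁ K := by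
      funext B; cases B <;> rfl
    have c₂ : (fun B => extI (Sum.elim f₁ f₂) K (σ₂ B)) = extI f₂ K := by
      funext B; cases B <;> rfl
    refine ⟨Sum.elim f₁ f₂, ?_, ?_⟩
    · rintro (B | B) w
      · simp only [Sum.elim_inl, denote_rename, c₁]; exact hf₁ B w
      · simp only [Sum.elim_inr, denote_rename, c₂]; exact hf₂ B w
    · intro w
      rw [choice_matcher _ _ _ (concatL (X \ {[]}) K) (concatL (Y \ {[]}) K)]
      · congr 1
        ext v
        simp only [concatL, Set.mem_union, Set.mem_ofPred_eq, Set.mem_sdiff]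
        constructor
        · rintro (⟨x, ⟨h1, h2⟩, h3⟩ | ⟨x, ⟨h1, h2⟩, h3⟩)
          · exact ⟨x, ⟨Or.inl h1, h2⟩, h3⟩
          · exact ⟨x, ⟨Or.inr h1, h2⟩, h3⟩
        · rintro ⟨x, ⟨h1 | h1, h2⟩, h3⟩
          · exact Or.inl ⟨x, ⟨h1, h2⟩, h3⟩
          · exact Or.inr ⟨x, ⟨h1, h2⟩, h3⟩
      · rw [denote_rename, c₁, hK₁]
      · rw [denote_rename, c₂, hK₂]

theorem concatL_split {A : Type} (X K : Set (List A)) :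
    {w | [] ∈ X ∧ w ∈ K} ∪ concatL (X \ {[]}) K = concatL X K := by
  ext v
  simp only [concatL, Set.mem_union, Set.mem_ofPred_eq, Set.mem_sdiff, Set.mem_singleton_iff]
  constructor
  · rintro (⟨h1, h2⟩ | ⟨x, ⟨h1, h2⟩, h3⟩)
    · exact ⟨[], h1, v, h2, rfl⟩
    · exact ⟨x, h1, h3⟩
  · rintro ⟨x, h1, y, h2, rfl⟩
    by_cases hx : x = []
    · subst hx; exact Or.inl ⟨h1, h2⟩
    · exact Or.inr ⟨x, ⟨h1, hx⟩, y, h2, rfl⟩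

theorem concatL_assoc {A : Type} (X Y K : Set (List A)) :
    concatL (concatL X Y) K = concatL X (concatL Y K) := by
  ext v
  constructor
  · rintro ⟨_, ⟨x, hx, y, hy, rfl⟩, k, hk, rfl⟩
    exact ⟨x, hx, _, ⟨y, hy, k, hk, rfl⟩, by simp⟩
  · rintro ⟨x, hx, _, ⟨y, hy, k, hk, rfl⟩, rfl⟩
    exact ⟨_, ⟨x, hx, y, hy, rfl⟩, k, hk, by simp⟩

theorem good_concat {A : Type} {X Y : Set (List A)} (hX : Good X) (hY : Good Y) :
    Good (concatL X Y) := by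
  obtain ⟨N₁, _, rule₁, e₁, rank₁, he₁, hr₁, h₁⟩ := hX
  obtain ⟨N₂, _, rule₂, e₂, rank₂, he₂, hr₂, h₂⟩ := hY
  let σ₁ : Option N₁ → Option (Option (N₁ ⊕ N₂)) := fun o => some (o.map Sum.inl)
  let σ₂ : Option N₂ → Option (Option (N₁ ⊕ N₂)) := Option.map (fun n => some (Sum.inr n))
  refine ⟨Option (N₁ ⊕ N₂), inferInstance,
    fun o => o.elim (.choice (.onlyIf ([] ∈ Y) (.nt none)) (e₂.rename σ₂))
      (Sum.elim (fun B => (rule₁ B).rename σ₁) (fun B => (rule₂ B).rename σ₂)),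
    .choice (.onlyIf ([] ∈ X) (e₂.rename σ₂)) (e₁.rename σ₁),
    fun o => o.elim 0 (Sum.elim (fun B => rank₁ B + 1) rank₂), ?_, ?_, ?_⟩
  · have := leftNts_onlyIf ([] ∈ X) (e₂.rename σ₂)
    simp only [leftNts_rename, he₂, Set.image_empty, Set.subset_empty_iff] at this
    simp [PExp.leftNts, leftNts_rename, he₁, this]
  · rintro (_ | B | B) C hC
    · exfalso
      have := leftNts_onlyIf ([] ∈ Y)
        (.nt none : PExp (Option (Option (N₁ ⊕ N₂))) A)
      simp only [Option.elim_none, PExp.leftNts, leftNts_rename, he₂, Set.image_empty,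
        Set.union_empty] at hC
      have := this hC
      simp [PExp.leftNts] at this
    · simp only [Option.elim_some, Sum.elim_inl, leftNts_rename] at hC
      obtain ⟨_ | D, hD, hDC⟩ := hC
      · simp only [σ₁, Option.some.injEq] at hDC
        subst hDC; simp
      · simp only [σ₁, Option.some.injEq] at hDC
        subst hDC; simpa using hr₁ _ _ hD
    · simp only [Option.elim_some, Sum.elim_inr, leftNts_rename] at hC
      obtain ⟨_ | D, hD, hDC⟩ := hC
      · simp [σ₂] at hDC
      · simp only [σ₂, Option.map_some, Option.some.injEq] at hDC
        subst hDC; exact hr₂ _ _ hD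
  · intro K
    obtain ⟨f₁, hf₁, hK₁⟩ := h₁ (concatL Y K)
    obtain ⟨f₂, hf₂, hK₂⟩ := h₂ K
    let f : Option (N₁ ⊕ N₂) → List A → Option (List A) :=
      fun o => o.elim (matcher (concatL Y K)) (Sum.elim f₁ f₂)
    have c₁ : (fun B => extI f K (σ₁ B)) = extI f₁ (concatL Y K) := by
      funext B; cases B <;> rfl
    have c₂ : (fun B => extI f K (σ₂ B)) = extI f₂ K := by
      funext B; cases B <;> rfl
    refine ⟨f, ?_, ?_⟩
    · rintro (_ | B | B) w
      · simp only [Option.elim_none]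
        rw [choice_matcher _ _ _ {w | [] ∈ Y ∧ w ∈ K} (concatL (Y \ {[]}) K),
          concatL_split]
        · rfl
        · exact onlyIf_matcher _ _ _ _ _ rfl
        · rw [denote_rename, c₂, hK₂]
      · simp only [Option.elim_some, Sum.elim_inl, denote_rename, c₁]; exact hf₁ B w
      · simp only [Option.elim_some, Sum.elim_inr, denote_rename, c₂]; exact hf₂ B w
    · intro w
      rw [choice_matcher _ _ _ {w | [] ∈ X ∧ w ∈ concatL (Y \ {[]}) K}
        (concatL (X \ {[]}) (concatL Y K))]
      · congr 1
        ext v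
        simp only [concatL, Set.mem_union, Set.mem_ofPred_eq, Set.mem_sdiff,
          Set.mem_singleton_iff]
        constructor
        · rintro (⟨h0, y, ⟨hy, hy'⟩, k, hk, rfl⟩ | ⟨x, ⟨hx, hx'⟩, _, ⟨y, hy, k, hk, rfl⟩, rfl⟩)
          · exact ⟨y, ⟨⟨[], h0, y, hy, rfl⟩, hy'⟩, k, hk, rfl⟩
          · exact ⟨x ++ y, ⟨⟨x, hx, y, hy, rfl⟩, by simp [hx']⟩, k, hk, by simp⟩
        · rintro ⟨_, ⟨⟨x, hx, y, hy, rfl⟩, hne⟩, k, hk, rfl⟩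
          by_cases hx' : x = []
          · subst hx'; exact Or.inl ⟨hx, y, ⟨hy, by simpa using hne⟩, k, hk, rfl⟩
          · exact Or.inr ⟨x, ⟨hx, hx'⟩, _, ⟨y, hy, k, hk, rfl⟩, by simp⟩
      · apply onlyIf_matcher
        rw [denote_rename, c₂, hK₂]
      · rw [denote_rename, c₁, hK₁]

theorem kstarL_eq {A : Type} (X K : Set (List A)) :
    K ∪ concatL (X \ {[]}) (concatL (kstarL X) K) = concatL (kstarL X) K := by
  ext v
  constructor
  · rintro (h | ⟨x, ⟨hx, _⟩, _, ⟨_, ⟨l, hl, rfl⟩, k, hk, rfl⟩, rfl⟩)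
    · exact ⟨[], ⟨[], by simp, rfl⟩, v, h, rfl⟩
    · refine ⟨_, ⟨x :: l, ?_, rfl⟩, k, hk, by simp⟩
      simpa [hx] using hl
  · rintro ⟨_, ⟨l, hl, rfl⟩, k, hk, rfl⟩
    induction l with
    | nil => exact Or.inl hk
    | cons x l ih =>
      by_cases hx : x = []
      · subst hx; simpa using ih (fun u hu => hl u (by simp [hu]))
      · exact Or.inr ⟨x, ⟨hl x (by simp), hx⟩, _, ⟨_, ⟨l, fun u hu => hl u (by simp [hu]), rfl⟩,
          k, hk, rfl⟩, by simp⟩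

theorem kstarL_diff {A : Type} (X K : Set (List A)) :
    concatL (X \ {[]}) (concatL (kstarL X) K) = concatL (kstarL X \ {[]}) K := by
  ext v
  constructor
  · rintro ⟨x, ⟨hx, hx'⟩, _, ⟨_, ⟨l, hl, rfl⟩, k, hk, rfl⟩, rfl⟩
    refine ⟨_, ⟨⟨x :: l, ?_, rfl⟩, ?_⟩, k, hk, by simp⟩
    · simpa [hx] using hl
    · simp only [Set.mem_singleton_iff] at hx'
      simp [hx']
  · rintro ⟨_, ⟨⟨l, hl, rfl⟩, hne⟩, k, hk, rfl⟩
    induction l with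
    | nil => simp at hne
    | cons x l ih =>
      by_cases hx : x = []
      · subst hx; simpa using ih (fun u hu => hl u (by simp [hu])) (by simpa using hne)
      · exact ⟨x, ⟨hl x (by simp), hx⟩, _, ⟨_, ⟨l, fun u hu => hl u (by simp [hu]), rfl⟩,
          k, hk, rfl⟩, by simp⟩

theorem good_star {A : Type} {X : Set (List A)} (hX : Good X) : Good (kstarL X) := by
  obtain ⟨N, _, rule, e, rank, he, hr, h⟩ := hX
  let σ : Option N → Option (Option N) := some
  refine ⟨Option N, inferInstance,
    fun o => o.elim (.choice (.nt none) (e.rename σ)) (fun B => (rule B).rename σ),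
    e.rename σ, fun o => o.elim 0 (fun B => rank B + 1), ?_, ?_, ?_⟩
  · simp [leftNts_rename, he]
  · rintro (_ | B) C hC
    · simp [PExp.leftNts, leftNts_rename, he] at hC
    · simp only [Option.elim_some, leftNts_rename] at hC
      obtain ⟨_ | D, hD, hDC⟩ := hC
      · simp only [σ, Option.some.injEq] at hDC
        subst hDC; simp
      · simp only [σ, Option.some.injEq] at hDC
        subst hDC; simpa using hr _ _ hD
  · intro K
    obtain ⟨f₁, hf₁, hK₁⟩ := h (concatL (kstarL X) K)
    let f : Option N → List A → Option (List A) :=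
      fun o => o.elim (matcher (concatL (kstarL X) K)) f₁
    have c₁ : (fun B => extI f K (σ B)) = extI f₁ (concatL (kstarL X) K) := by
      funext B; cases B <;> rfl
    refine ⟨f, ?_, ?_⟩
    · rintro (_ | B) w
      · simp only [Option.elim_none]
        rw [choice_matcher _ _ _ K (concatL (X \ {[]}) (concatL (kstarL X) K)),
          kstarL_eq]
        · rfl
        · rfl
        · rw [denote_rename, c₁, hK₁]
      · simp only [Option.elim_some, denote_rename, c₁]; exact hf₁ B w
    · intro w
      rw [denote_rename, c₁, hK₁, kstarL_diff]

/-! ### Closing an open grammar with a PEG -/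

theorem isPEL_of_good {A : Type} [Finite A] {X Y : Set (List A)} (hX : Good X) (hY : IsPEL Y) :
    IsPEL (concatL X Y) := by
  obtain ⟨N, _, rule, e, rank, he, hr, h⟩ := hX
  obtain ⟨M, _, G, hG, rfl⟩ := hY
  obtain ⟨rankG, hrG⟩ := rank_of_wellFormed hG
  obtain ⟨g, hg⟩ := exists_interp rankG hrG
  obtain ⟨f₁, hf₁, hK⟩ := h G.Lang
  obtain ⟨b, hb⟩ := (Set.finite_range rankG).bddAbove
  obtain ⟨b', hb'⟩ := (Set.finite_range rank).bddAbove
  obtain ⟨la, -, hla⟩ := Finite.exists_univ_list A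
  -- nonterminals: `none` start, `some none` the end-anchored axiom of `G`
  let T := Option (Option (N ⊕ M))
  let σ : Option N → T := fun o => some (o.map Sum.inl)
  let τ : M → T := fun B => some (some (Sum.inr B))
  let G' : PEG T A :=
    { rule := fun o => o.elim (.choice (.onlyIf ([] ∈ X) (.nt (some none))) (e.rename σ))
        (fun o => o.elim (.seq (.nt (τ G.start)) (.not (PExp.big (fun a => .term a) la)))
          (Sum.elim (fun B => (rule B).rename σ) (fun B => (G.rule B).rename τ)))
      start := none }
  let rk : T → ℕ := fun o => o.elim (b + b' + 3)
        (fun o => o.elim (b + 1) (Sum.elim (fun B => rank B + b + 2) rankG))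
  have hrk : ∀ B C, C ∈ (G'.rule B).leftNts → rk C < rk B := by
    rintro (_ | _ | B | B) C hC
    · simp only [G', Option.elim_none, PExp.leftNts, leftNts_rename, he, Set.image_empty,
        Set.union_empty] at hC
      have := leftNts_onlyIf _ _ hC
      simp only [PExp.leftNts, Set.mem_singleton_iff] at this
      subst this
      simp only [rk, Option.elim_some, Option.elim_none]; omega
    · have hbig : (PExp.big (fun a => (.term a : PExp T A)) la).leftNts = ∅ :=
        leftNts_big _ _ (fun _ => rfl)
      simp only [G', Option.elim_none, Option.elim_some, PExp.leftNts, hbig] at hC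
      simp only [ite_self, Set.union_empty, Set.mem_singleton_iff] at hC
      subst hC
      have := hb ⟨G.start, rfl⟩
      simp only [rk, τ, Option.elim_some, Option.elim_none, Sum.elim_inr]; omega
    · simp only [G', Option.elim_some, Sum.elim_inl, leftNts_rename] at hC
      obtain ⟨_ | D, hD, rfl⟩ := hC
      · simp only [rk, σ, Option.elim_some, Option.map_none, Option.elim_none, Sum.elim_inl]
        omega
      · have := hr _ _ hD
        simp only [rk, σ, Option.elim_some, Option.map_some, Sum.elim_inl]
        omega
    · simp only [G', Option.elim_some, Sum.elim_inr, leftNts_rename] at hC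
      obtain ⟨D, hD, rfl⟩ := hC
      exact hrG _ _ hD
  let f : T → List A → Option (List A) := fun o => o.elim (matcher (concatL X G.Lang))
    (fun o => o.elim (matcher G.Lang) (Sum.elim f₁ g))
  have c₁ : (fun B => f (σ B)) = extI f₁ G.Lang := by
    funext B; cases B <;> rfl
  have c₂ : (fun B => f (τ B)) = g := rfl
  have hf : ∀ B w, f B w = denote f (G'.rule B) w := by
    rintro (_ | _ | B | B) w
    · simp only [G', Option.elim_none]
      rw [choice_matcher _ _ _ {w | [] ∈ X ∧ w ∈ G.Lang} (concatL (X \ {[]}) G.Lang),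
        concatL_split]
      · rfl
      · exact onlyIf_matcher _ _ _ _ _ rfl
      · rw [denote_rename, c₁, hK]
    · apply Option.ext
      intro u
      simp only [G', Option.elim_none, Option.elim_some]
      rw [denote_seq_some]
      change matcher G.Lang w = some u ↔ _
      have hlang : w ∈ G.Lang ↔ g G.start w = some [] := by
        have := parses_iff rankG hrG hg (.nt G.start) w (some [])
        exact this
      rw [matcher_some, hlang]
      have hany : ∀ v, denote f (.not (PExp.big (fun a => .term a) la)) v = some u ↔
          v = [] ∧ u = [] := by
        intro v
        have hs : ∀ s, denote f (PExp.big (fun a => .term a) la) v = some s ↔ ∃ a, v = a :: s := by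
          intro s
          rw [denote_big_some]
          · simp only [denote_term_some]
            exact ⟨fun ⟨i, _, h⟩ => ⟨i, h⟩, fun ⟨i, h⟩ => ⟨i, hla i, h⟩⟩
          · intro i j s t h1 h2
            rw [denote_term_some] at h1 h2
            rw [h1] at h2; exact (List.cons.inj h2).2
        simp only [denote]
        cases hv : denote f (PExp.big (fun a => .term a) la) v with
        | none =>
          cases v with
          | nil => simp [eq_comm]
          | cons a s =>
            have := (hs s).2 ⟨a, rfl⟩
            rw [hv] at this; cases this
        | some s =>
          obtain ⟨a, rfl⟩ := (hs s).1 hv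
          simp
      simp only [hany]
      change _ ↔ ∃ v, g G.start w = some v ∧ _
      constructor
      · rintro ⟨h1, h2⟩; exact ⟨[], h1, rfl, h2⟩
      · rintro ⟨v, h1, rfl, h2⟩; exact ⟨h1, h2⟩
    · simp only [G', Option.elim_some, Sum.elim_inl, denote_rename, c₁]; exact hf₁ B w
    · simp only [G', Option.elim_some, Sum.elim_inr, denote_rename, c₂]; exact hg B w
  refine ⟨T, inferInstance, G', wellFormed_of_rank rk hrk, ?_⟩
  ext w
  change Parses G' (.nt none) w (some []) ↔ _
  rw [parses_iff rk hrk hf]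
  change matcher (concatL X G.Lang) w = some [] ↔ _
  rw [matcher_some]; simp

end Eval

/-! ### DPDA runs -/

section Runs

variable {Q A Γ : Type} (M : DPDA Q A Γ)

/-- Runs. -/
abbrev DPDA.Run (c d : Q × List Γ × List A) : Prop := Relation.ReflTransGen (DPDA.Step M) c d

/-- One ε-move on (state, stack). -/
def DPDA.EStep (c d : Q × List Γ) : Prop :=
  ∃ q Z γ p β, c = (q, Z :: γ) ∧ d = (p, β ++ γ) ∧ M.transE q Z = some (p, β)

/-- ε-runs. -/
abbrev DPDA.ERun (c d : Q × List Γ) : Prop := Relation.ReflTransGen M.EStep c d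

variable {M}

theorem estep_det {c d d' : Q × List Γ} (h : M.EStep c d) (h' : M.EStep c d') : d = d' := by
  obtain ⟨q, Z, γ, p, β, rfl, rfl, ht⟩ := h
  obtain ⟨q', Z', γ', p', β', h1, rfl, ht'⟩ := h'
  simp only [Prod.mk.injEq, List.cons.injEq] at h1
  obtain ⟨rfl, rfl, rfl⟩ := h1
  rw [ht] at ht'
  simp only [Option.some.injEq, Prod.mk.injEq] at ht'
  rw [ht'.1, ht'.2]

theorem step_det {c d d' : Q × List Γ × List A} (h : M.Step c d) (h' : M.Step c d') : d = d' := by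
  cases h with
  | readA h1 =>
    cases h' with
    | readA h2 => rw [h1] at h2; cases h2; rfl
    | readE h2 =>
      have := M.det _ _ (by rw [h2]; simp)
      rw [this] at h1; cases h1
  | readE h1 =>
    cases h' with
    | readA h2 =>
      have := M.det _ _ (by rw [h1]; simp)
      rw [this] at h2; cases h2
    | readE h2 => rw [h1] at h2; cases h2; rfl

theorem rtg_normal_unique {α : Type} {r : α → α → Prop}
    (hdet : ∀ a b c, r a b → r a c → b = c) {a b c : α}
    (h1 : Relation.ReflTransGen r a b) (h2 : Relation.ReflTransGen r a c)
    (hb : ∀ x, ¬ r b x) (hc : ∀ x, ¬ r c x) : b = c := by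
  induction h1 using Relation.ReflTransGen.head_induction_on with
  | refl =>
    rcases Relation.ReflTransGen.cases_head h2 with h | ⟨x, hx, _⟩
    · exact h
    · exact absurd hx (hb x)
  | head h _ ih =>
    rcases Relation.ReflTransGen.cases_head h2 with h' | ⟨x, hx, h'⟩
    · subst h'; exact absurd h (hc _)
    · rw [hdet _ _ _ h hx] at ih; exact ih h'

theorem run_pop_unique {c : Q × List Γ × List A} {p p' : Q} {u u' : List A}
    (h : M.Run c (p, [], u)) (h' : M.Run c (p', [], u')) : p = p' ∧ u = u' := by
  have : (p, ([] : List Γ), u) = (p', [], u') :=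
    rtg_normal_unique (r := M.Step) (fun _ _ _ => step_det) h h' (fun x hx => nomatch hx)
      (fun x hx => nomatch hx)
  simpa using this

theorem erun_read_unique {c : Q × List Γ} {q q' : Q} {Z Z' : Γ} {γ γ' : List Γ}
    (h : M.ERun c (q, Z :: γ)) (h' : M.ERun c (q', Z' :: γ'))
    (hE : M.transE q Z = none) (hE' : M.transE q' Z' = none) :
    q = q' ∧ Z = Z' ∧ γ = γ' := by
  have : (q, Z :: γ) = (q', Z' :: γ') := by
    refine rtg_normal_unique (r := M.EStep) (fun _ _ _ => estep_det) h h' ?_ ?_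
    · rintro x ⟨_, _, _, _, _, h1, _, h2⟩
      simp only [Prod.mk.injEq, List.cons.injEq] at h1
      obtain ⟨rfl, rfl, rfl⟩ := h1
      rw [hE] at h2; cases h2
    · rintro x ⟨_, _, _, _, _, h1, _, h2⟩
      simp only [Prod.mk.injEq, List.cons.injEq] at h1
      obtain ⟨rfl, rfl, rfl⟩ := h1
      rw [hE'] at h2; cases h2
  simpa using this

theorem run_of_erun {c d : Q × List Γ} (h : M.ERun c d) (w : List A) :
    M.Run (c.1, c.2, w) (d.1, d.2, w) := by
  induction h with
  | refl => exact .refl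
  | tail _ h ih =>
    obtain ⟨q, Z, γ, p, β, rfl, rfl, ht⟩ := h
    exact ih.tail (.readE ht)

theorem run_suffix {c d : Q × List Γ × List A} (h : M.Run c d) :
    ∃ x, c.2.2 = x ++ d.2.2 ∧ M.Run (c.1, c.2.1, x) (d.1, d.2.1, []) := by
  induction h using Relation.ReflTransGen.head_induction_on with
  | refl => exact ⟨[], rfl, .refl⟩
  | head h _ ih =>
    obtain ⟨x, hx, hr⟩ := ih
    cases h with
    | @readA q a Z γ u p β ht =>
      simp only at hx hr
      exact ⟨a :: x, by simp [hx], Relation.ReflTransGen.head (.readA ht) hr⟩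
    | readE ht =>
      simp only at hx hr
      exact ⟨x, hx, Relation.ReflTransGen.head (.readE ht) hr⟩

theorem run_append_input {c d : Q × List Γ × List A} (h : M.Run c d) (y : List A) :
    M.Run (c.1, c.2.1, c.2.2 ++ y) (d.1, d.2.1, d.2.2 ++ y) := by
  induction h with
  | refl => exact .refl
  | tail _ h ih =>
    cases h with
    | readA ht => exact ih.tail (.readA ht)
    | readE ht => exact ih.tail (.readE ht)

theorem run_append_stack {c d : Q × List Γ × List A} (h : M.Run c d) (δ : List Γ) :
    M.Run (c.1, c.2.1 ++ δ, c.2.2) (d.1, d.2.1 ++ δ, d.2.2) := by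
  induction h with
  | refl => exact .refl
  | tail _ h ih =>
    cases h with
    | @readA q a Z γ u p β ht =>
      refine ih.tail ?_
      have := DPDA.Step.readA (M := M) (γ := γ ++ δ) (u := u) ht
      simpa [List.append_assoc] using this
    | @readE q Z γ u p β ht =>
      refine ih.tail ?_
      have := DPDA.Step.readE (M := M) (γ := γ ++ δ) (u := u) ht
      simpa [List.append_assoc] using this

theorem run_decomp {c : Q × List Γ × List A} {p : Q} {δ : List Γ} {u : List A}
    (h : M.Run c (p, δ, u)) : ∀ α γ, c.2.1 = α ++ γ →
    (∃ δ', δ = δ' ++ γ ∧ M.Run (c.1, α, c.2.2) (p, δ', u)) ∨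
    (∃ p₁ u₁, M.Run (c.1, α, c.2.2) (p₁, [], u₁) ∧ M.Run (p₁, γ, u₁) (p, δ, u)) := by
  induction h using Relation.ReflTransGen.head_induction_on with
  | refl => intro α γ h; exact Or.inl ⟨α, h, .refl⟩
  | @head c c' h hrest ih =>
    intro α γ hα
    cases α with
    | nil =>
      refine Or.inr ⟨c.1, c.2.2, .refl, ?_⟩
      simp only [List.nil_append] at hα
      rw [← hα]
      exact Relation.ReflTransGen.head h hrest
    | cons Z α =>
      cases h with
      | @readA q a Z' γ' v p' β ht =>
        simp only [List.cons_append, List.cons.injEq] at hα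
        obtain ⟨rfl, rfl⟩ := hα
        have hs : M.Step (q, Z' :: α, a :: v) (p', β ++ α, v) := .readA ht
        rcases ih (β ++ α) γ (by simp) with ⟨δ', hδ, h'⟩ | ⟨p₁, u₁, h1, h2⟩
        · exact Or.inl ⟨δ', hδ, Relation.ReflTransGen.head hs h'⟩
        · exact Or.inr ⟨p₁, u₁, Relation.ReflTransGen.head hs h1, h2⟩
      | @readE q Z' γ' v p' β ht =>
        simp only [List.cons_append, List.cons.injEq] at hα
        obtain ⟨rfl, rfl⟩ := hα
        have hs : M.Step (q, Z' :: α, v) (p', β ++ α, v) := .readE ht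
        rcases ih (β ++ α) γ (by simp) with ⟨δ', hδ, h'⟩ | ⟨p₁, u₁, h1, h2⟩
        · exact Or.inl ⟨δ', hδ, Relation.ReflTransGen.head hs h'⟩
        · exact Or.inr ⟨p₁, u₁, Relation.ReflTransGen.head hs h1, h2⟩

theorem run_nil {q p : Q} {δ : List Γ} {w u : List A} (h : M.Run (q, [], w) (p, δ, u)) :
    q = p ∧ δ = [] ∧ w = u := by
  rcases Relation.ReflTransGen.cases_head h with h | ⟨x, hx, _⟩
  · simp only [Prod.mk.injEq] at h
    exact ⟨h.1, h.2.1.symm, h.2.2⟩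
  · cases hx

/-- The first reading move of a run. -/
theorem run_first {c : Q × List Γ × List A} {p : Q} {δ : List Γ} {u : List A}
    (h : M.Run c (p, δ, u)) :
    (M.ERun (c.1, c.2.1) (p, δ) ∧ c.2.2 = u) ∨
    (∃ q' Z' γ' a w' p' β, M.ERun (c.1, c.2.1) (q', Z' :: γ') ∧ c.2.2 = a :: w' ∧
      M.transA q' a Z' = some (p', β) ∧ M.Run (p', β ++ γ', w') (p, δ, u)) := by
  induction h using Relation.ReflTransGen.head_induction_on with
  | refl => exact Or.inl ⟨.refl, rfl⟩
  | head h hrest ih =>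
    cases h with
    | readA ht => exact Or.inr ⟨_, _, _, _, _, _, _, .refl, rfl, ht, hrest⟩
    | @readE q Z γ v p' β ht =>
      have hs : M.EStep (q, Z :: γ) (p', β ++ γ) := ⟨q, Z, γ, p', β, rfl, rfl, ht⟩
      rcases ih with ⟨h1, h2⟩ | ⟨q', Z', γ', a, w', p'', β', h1, h2⟩
      · exact Or.inl ⟨Relation.ReflTransGen.head hs h1, h2⟩
      · exact Or.inr ⟨q', Z', γ', a, w', p'', β', Relation.ReflTransGen.head hs h1, h2⟩

theorem transE_none_of_transA {q : Q} {a : A} {Z : Γ} {x : Q × List Γ}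
    (h : M.transA q a Z = some x) : M.transE q Z = none := by
  by_contra hc
  rw [M.det q Z hc a] at h; cases h

open Classical in
/-- The reading configuration reached by ε-moves. -/
noncomputable def DPDA.readConf (M : DPDA Q A Γ) (q : Q) (Z : Γ) : Option (Q × Γ × List Γ) :=
  if h : ∃ x : Q × Γ × List Γ, M.ERun (q, [Z]) (x.1, x.2.1 :: x.2.2) ∧ M.transE x.1 x.2.1 = none
  then some h.choose else none

theorem readConf_some {q : Q} {Z : Γ} {q' : Q} {Z' : Γ} {γ : List Γ} :
    M.readConf q Z = some (q', Z', γ) ↔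
      M.ERun (q, [Z]) (q', Z' :: γ) ∧ M.transE q' Z' = none := by
  unfold DPDA.readConf
  split
  · rename_i h
    simp only [Option.some.injEq]
    constructor
    · intro he
      have := h.choose_spec
      rw [he] at this; exact this
    · rintro ⟨h1, h2⟩
      obtain ⟨h3, h4⟩ := h.choose_spec
      obtain ⟨e1, e2, e3⟩ := erun_read_unique h3 h1 h4 h2
      exact Prod.ext e1 (Prod.ext e2 e3)
  · rename_i h
    simp only [reduceCtorEq, false_iff]
    intro h'
    exact h ⟨(q', Z', γ), h'⟩

/-- Nonterminals: pop triples and acceptance pairs. -/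
abbrev DNT (Q Γ : Type) : Type := (Q × Γ × Q) ⊕ (Q × Γ)

open Classical in
/-- Pop a whole stack. -/
noncomputable def popSeq (A : Type) (lq : List Q) : Q → List Γ → Q → PExp (Option (DNT Q Γ)) A
  | q, [], p => if q = p then .eps else .fail
  | q, Z :: γ, p =>
    PExp.big (fun p₁ => .seq (.nt (some (.inl (q, Z, p₁)))) (popSeq A lq p₁ γ p)) lq

/-- Reach a final state with remaining input in the continuation, starting from a stack. -/
noncomputable def accSeq (M : DPDA Q A Γ) (lq : List Q) : Q → List Γ → PExp (Option (DNT Q Γ)) A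
  | q, [] => .onlyIf (M.final q = true) (.nt none)
  | q, Z :: γ => .choice (.nt (some (.inr (q, Z))))
    (PExp.big (fun p₁ => .seq (.nt (some (.inl (q, Z, p₁)))) (accSeq M lq p₁ γ)) lq)

/-- Do the ε-moves, read a letter, and continue. -/
noncomputable def readPart {N : Type} (M : DPDA Q A Γ) (la : List A) (q : Q) (Z : Γ)
    (k : Q → List Γ → PExp N A) : PExp N A :=
  match M.readConf q Z with
  | none => .fail
  | some (q', Z', γ) => PExp.big (fun a => .seq (.term a) (match M.transA q' a Z' with
    | none => .fail
    | some (p', β) => k p' (β ++ γ))) la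

theorem leftNts_readPart {N : Type} (M : DPDA Q A Γ) (la : List A) (q : Q) (Z : Γ)
    (k : Q → List Γ → PExp N A) : (readPart M la q Z k).leftNts = ∅ := by
  unfold readPart
  split
  · rfl
  · apply leftNts_big
    intro a
    simp [PExp.leftNts, PExp.maybeEmpty]

theorem denote_readPart {N : Type} (f : N → List A → Option (List A)) (la : List A)
    (hla : ∀ a, a ∈ la) (q : Q) (Z : Γ) (k : Q → List Γ → PExp N A) (w u : List A) :
    denote f (readPart M la q Z k) w = some u ↔
    ∃ q' Z' γ a w' p' β, M.ERun (q, [Z]) (q', Z' :: γ) ∧ w = a :: w' ∧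
      M.transA q' a Z' = some (p', β) ∧ denote f (k p' (β ++ γ)) w' = some u := by
  unfold readPart
  cases hc : M.readConf q Z with
  | none =>
    simp only [denote_fail, reduceCtorEq, false_iff]
    rintro ⟨q', Z', γ, a, w', p', β, h1, h2, h3, h4⟩
    have := readConf_some.2 ⟨h1, transE_none_of_transA h3⟩
    rw [hc] at this; cases this
  | some x =>
    obtain ⟨q₀, Z₀, γ₀⟩ := x
    obtain ⟨hr, hE⟩ := readConf_some.1 hc
    simp only
    rw [denote_big_some]
    · simp only [denote_seq_some, denote_term_some]
      constructor
      · rintro ⟨a, _, w', rfl, h⟩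
        cases ht : M.transA q₀ a Z₀ with
        | none => rw [ht] at h; simp at h
        | some y =>
          obtain ⟨p', β⟩ := y
          rw [ht] at h
          exact ⟨q₀, Z₀, γ₀, a, w', p', β, hr, rfl, ht, h⟩
      · rintro ⟨q', Z', γ, a, w', p', β, h1, rfl, h3, h4⟩
        obtain ⟨rfl, rfl, rfl⟩ := erun_read_unique hr h1 hE (transE_none_of_transA h3)
        refine ⟨a, hla a, w', rfl, ?_⟩
        rw [h3]; exact h4
    · intro i j s t h1 h2
      rw [denote_seq_some] at h1 h2
      obtain ⟨v, h1, h1'⟩ := h1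
      obtain ⟨v', h2, h2'⟩ := h2
      rw [denote_term_some] at h1 h2
      rw [h1] at h2
      obtain ⟨rfl, rfl⟩ := List.cons.inj h2
      rw [h1'] at h2'
      exact Option.some.inj h2'

theorem run_cons_pop {q p₁ : Q} {Z : Γ} {γ : List Γ} {w u₁ : List A} {c : Q × List Γ × List A}
    (h1 : M.Run (q, [Z], w) (p₁, [], u₁)) (h2 : M.Run (p₁, γ, u₁) c) :
    M.Run (q, Z :: γ, w) c :=
  (run_append_stack h1 γ).trans h2

theorem denote_popSeq (f : Option (DNT Q Γ) → List A → Option (List A)) (lq : List Q)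
    (hlq : ∀ q, q ∈ lq)
    (hf : ∀ q Z p w u, f (some (.inl (q, Z, p))) w = some u ↔ M.Run (q, [Z], w) (p, [], u))
    (γ : List Γ) (q p : Q) (w u : List A) :
    denote f (popSeq A lq q γ p) w = some u ↔ M.Run (q, γ, w) (p, [], u) := by
  induction γ generalizing q w u with
  | nil =>
    unfold popSeq
    split
    · rename_i h
      subst h
      simp only [denote, Option.some.injEq]
      constructor
      · rintro rfl; exact .refl
      · intro h; exact (run_nil h).2.2
    · rename_i h
      simp only [denote_fail, reduceCtorEq, false_iff]
      exact fun h' => h (run_nil h').1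
  | cons Z γ ih =>
    have key : ∀ p₁ u, denote f (.seq (.nt (some (.inl (q, Z, p₁)))) (popSeq A lq p₁ γ p)) w = some u
        ↔ ∃ v, M.Run (q, [Z], w) (p₁, [], v) ∧ M.Run (p₁, γ, v) (p, [], u) := by
      intro p₁ u
      rw [denote_seq_some]
      simp only [ih]
      simp only [denote, hf]
    rw [popSeq, denote_big_some]
    · simp only [key]
      constructor
      · rintro ⟨p₁, _, v, h1, h2⟩; exact run_cons_pop h1 h2
      · intro h
        rcases run_decomp h [Z] γ rfl with ⟨δ', hδ, h'⟩ | ⟨p₁, u₁, h1, h2⟩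
        · obtain ⟨rfl, rfl⟩ := List.append_eq_nil_iff.1 hδ.symm
          exact ⟨p, hlq _, u, h', .refl⟩
        · exact ⟨p₁, hlq _, u₁, h1, h2⟩
    · intro i j s t h1 h2
      obtain ⟨v, h1, h1'⟩ := (key _ _).1 h1
      obtain ⟨v', h2, h2'⟩ := (key _ _).1 h2
      exact (run_pop_unique (run_cons_pop h1 h1') (run_cons_pop h2 h2')).2

/-- Inputs from which a final state is reachable with the rest in `K`. -/
def accSet (M : DPDA Q A Γ) (K : Set (List A)) (q : Q) (γ : List Γ) : Set (List A) :=
  {w | ∃ p δ u, M.Run (q, γ, w) (p, δ, u) ∧ M.final p = true ∧ u ∈ K}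

theorem denote_accSeq (f : Option (DNT Q Γ) → List A → Option (List A)) (lq : List Q)
    (hlq : ∀ q, q ∈ lq) (K : Set (List A)) (hK : f none = matcher K)
    (hf : ∀ q Z p w u, f (some (.inl (q, Z, p))) w = some u ↔ M.Run (q, [Z], w) (p, [], u))
    (hg : ∀ q Z w, f (some (.inr (q, Z))) w = matcher (accSet M K q [Z]) w)
    (γ : List Γ) (q : Q) (w : List A) :
    denote f (accSeq M lq q γ) w = matcher (accSet M K q γ) w := by
  induction γ generalizing q w with
  | nil =>
    rw [accSeq, onlyIf_matcher _ _ _ K]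
    · congr 1
      ext v
      constructor
      · rintro ⟨h1, h2⟩; exact ⟨q, [], v, .refl, h1, h2⟩
      · rintro ⟨p, δ, u, h, h1, h2⟩
        obtain ⟨rfl, _, rfl⟩ := run_nil h
        exact ⟨h1, h2⟩
    · simp only [denote, hK]
  | cons Z γ ih =>
    have key : ∀ p₁ u, denote f (.seq (.nt (some (.inl (q, Z, p₁)))) (accSeq M lq p₁ γ)) w = some u
        ↔ ∃ v, M.Run (q, [Z], w) (p₁, [], v) ∧ v ∈ accSet M K p₁ γ ∧ u = [] := by
      intro p₁ u
      rw [denote_seq_some]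
      simp only [ih, matcher_some]
      simp only [denote, hf]
    rw [accSeq, choice_matcher _ _ _ (accSet M K q [Z])
      {w | ∃ p₁ v, M.Run (q, [Z], w) (p₁, [], v) ∧ v ∈ accSet M K p₁ γ}]
    · congr 1
      ext x
      constructor
      · rintro (⟨p, δ, u, h, h1, h2⟩ | ⟨p₁, v, h, p, δ, u, h', h1, h2⟩)
        · exact ⟨p, δ ++ γ, u, run_append_stack h γ, h1, h2⟩
        · exact ⟨p, δ, u, run_cons_pop h h', h1, h2⟩
      · rintro ⟨p, δ, u, h, h1, h2⟩
        rcases run_decomp h [Z] γ rfl with ⟨δ', _, h'⟩ | ⟨p₁, u₁, h3, h4⟩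
        · exact Or.inl ⟨p, δ', u, h', h1, h2⟩
        · exact Or.inr ⟨p₁, u₁, h3, p, δ, u, h4, h1, h2⟩
    · simp only [denote, hg]
    · apply Option.ext
      intro u
      rw [denote_big_some]
      · simp only [key, matcher_some]
        constructor
        · rintro ⟨p₁, _, v, h1, h2, h3⟩; exact ⟨⟨p₁, v, h1, h2⟩, h3⟩
        · rintro ⟨⟨p₁, v, h1, h2⟩, h3⟩; exact ⟨p₁, hlq _, v, h1, h2, h3⟩
      · intro i j s t h1 h2
        obtain ⟨v, _, _, h1⟩ := (key _ _).1 h1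
        obtain ⟨v', _, _, h2⟩ := (key _ _).1 h2
        rw [h1, h2]

open Classical in
/-- The unique witness of a predicate, if any. -/
noncomputable def optOf {α : Type} (P : α → Prop) : Option α :=
  if h : ∃ x, P x then some h.choose else none

theorem optOf_some {α : Type} {P : α → Prop} (hP : ∀ x y, P x → P y → x = y) (x : α) :
    optOf P = some x ↔ P x := by
  unfold optOf
  split
  · rename_i h
    simp only [Option.some.injEq]
    constructor
    · rintro rfl; exact h.choose_spec
    · exact hP _ _ h.choose_spec
  · rename_i h
    simp only [reduceCtorEq, false_iff]
    exact fun hx => h ⟨x, hx⟩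

theorem run_of_first {q : Q} {Z : Γ} {q' : Q} {Z' : Γ} {γ : List Γ} {a : A} {w' : List A} {p' : Q}
    {β : List Γ} {c : Q × List Γ × List A} (h1 : M.ERun (q, [Z]) (q', Z' :: γ))
    (h2 : M.transA q' a Z' = some (p', β)) (h3 : M.Run (p', β ++ γ, w') c) :
    M.Run (q, [Z], a :: w') c :=
  (run_of_erun h1 (a :: w')).trans (Relation.ReflTransGen.head (.readA h2) h3)

open Classical in
theorem good_dcfl {L : Set (List A)} [Finite A] (hL : IsDCFL L) : Good L := by
  obtain ⟨Q, Γ, _, _, M, rfl⟩ := hL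
  obtain ⟨la, -, hla⟩ := Finite.exists_univ_list A
  obtain ⟨lq, -, hlq⟩ := Finite.exists_univ_list Q
  refine ⟨DNT Q Γ, inferInstance,
    Sum.elim
      (fun x => if M.ERun (x.1, [x.2.1]) (x.2.2, []) then .eps else
        readPart M la x.1 x.2.1 (fun p' γ => popSeq A lq p' γ x.2.2))
      (fun x => .choice (.onlyIf (∃ p δ, M.ERun (x.1, [x.2]) (p, δ) ∧ M.final p = true) (.nt none))
        (readPart M la x.1 x.2 (accSeq M lq))),
    readPart M la M.init M.Z0 (accSeq M lq), fun _ => 0, leftNts_readPart _ _ _ _ _, ?_, ?_⟩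
  · rintro (x | x) C hC
    · exfalso
      simp only [Sum.elim_inl] at hC
      split at hC
      · exact hC
      · rw [leftNts_readPart] at hC; exact hC
    · exfalso
      simp only [Sum.elim_inr, PExp.leftNts, leftNts_readPart, Set.union_empty] at hC
      have := leftNts_onlyIf _ _ hC
      simp [PExp.leftNts] at this
  · intro K
    let f : DNT Q Γ → List A → Option (List A) :=
      Sum.elim (fun x w => optOf (fun u => M.Run (x.1, [x.2.1], w) (x.2.2, [], u)))
        (fun x => matcher (accSet M K x.1 [x.2]))
    have hf : ∀ q Z p w u, extI f K (some (.inl (q, Z, p))) w = some u ↔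
        M.Run (q, [Z], w) (p, [], u) := by
      intro q Z p w u
      exact optOf_some (fun x y hx hy => (run_pop_unique hx hy).2) u
    have hg : ∀ q Z w, extI f K (some (.inr (q, Z))) w = matcher (accSet M K q [Z]) w :=
      fun q Z w => rfl
    have hplus : ∀ q Z w, denote (extI f K) (readPart M la q Z (accSeq M lq)) w =
        matcher {w | ∃ p δ u, M.Run (q, [Z], w) (p, δ, u) ∧ M.final p = true ∧ u ∈ K ∧ w ≠ u}
          w := by
      intro q Z w
      apply Option.ext
      intro u
      rw [denote_readPart _ la hla, matcher_some]
      simp only [denote_accSeq _ lq hlq K rfl hf hg, matcher_some]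
      constructor
      · rintro ⟨q', Z', γ, a, w', p', β, h1, rfl, h3, ⟨p, δ, v, h4, h5, h6⟩, rfl⟩
        refine ⟨⟨p, δ, v, run_of_first h1 h3 h4, h5, h6, ?_⟩, rfl⟩
        obtain ⟨x, hx, _⟩ := run_suffix h4
        simp only at hx
        rintro rfl
        have := congrArg List.length hx
        simp at this
        omega
      · rintro ⟨⟨p, δ, v, h4, h5, h6, h7⟩, rfl⟩
        rcases run_first h4 with ⟨_, h⟩ | ⟨q', Z', γ, a, w', p', β, h1, h2, h3, h8⟩
        · exact absurd h h7
        · exact ⟨q', Z', γ, a, w', p', β, h1, h2, h3, ⟨p, δ, v, h8, h5, h6⟩, rfl⟩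
    refine ⟨f, ?_, ?_⟩
    · rintro (⟨q, Z, p⟩ | ⟨q, Z⟩) w
      · apply Option.ext
        intro u
        change extI f K (some (.inl (q, Z, p))) w = some u ↔ _
        rw [hf]
        simp only [Sum.elim_inl]
        split
        · rename_i he
          have hr := run_of_erun he w
          simp only [denote, Option.some.injEq]
          constructor
          · intro h; exact (run_pop_unique hr h).2
          · rintro rfl; exact hr
        · rename_i he
          rw [denote_readPart _ la hla]
          simp only [denote_popSeq _ lq hlq hf]
          constructor
          · intro h
            rcases run_first h with ⟨h', _⟩ | h'
            · exact absurd h' he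
            · exact h'
          · rintro ⟨q', Z', γ, a, w', p', β, h1, rfl, h3, h4⟩
            exact run_of_first h1 h3 h4
      · change matcher (accSet M K q [Z]) w = _
        simp only [Sum.elim_inr]
        rw [choice_matcher _ _ _ _ _ _ (onlyIf_matcher _ _ _ K _ rfl) (hplus q Z w)]
        congr 1
        ext v
        constructor
        · rintro ⟨p, δ, u, h1, h2, h3⟩
          by_cases hv : v = u
          · subst hv
            rcases run_first h1 with ⟨h, _⟩ | ⟨q', Z', γ, a, w', p', β, _, h5, _, h8⟩
            · exact Or.inl ⟨⟨p, δ, h, h2⟩, h3⟩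
            · exfalso
              obtain ⟨x, hx, _⟩ := run_suffix h8
              simp only at hx h5
              have := congrArg List.length hx
              have := congrArg List.length h5
              simp at *
              omega
          · exact Or.inr ⟨p, δ, u, h1, h2, h3, hv⟩
        · rintro (⟨⟨p, δ, h, h2⟩, h3⟩ | ⟨p, δ, u, h1, h2, h3, _⟩)
          · exact ⟨p, δ, v, run_of_erun h v, h2, h3⟩
          · exact ⟨p, δ, u, h1, h2, h3⟩
    · intro w
      rw [hplus]
      congr 1
      ext v
      constructor
      · rintro ⟨p, δ, u, h1, h2, h3, h4⟩
        obtain ⟨x, hx, hr⟩ := run_suffix h1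
        simp only at hx hr
        refine ⟨x, ⟨⟨p, δ, hr, h2⟩, ?_⟩, u, h3, hx⟩
        rintro rfl
        exact h4 (by simpa using hx)
      · rintro ⟨x, ⟨⟨p, δ, hr, h2⟩, hne⟩, u, h3, rfl⟩
        refine ⟨p, δ, u, ?_, h2, h3, ?_⟩
        · simpa using run_append_input hr u
        · intro h
          apply hne
          simpa using h

end Runs

theorem good_of_regClosure {A : Type} [Finite A] {X : Set (List A)} (h : RegClosureDCFL X) :
    Good X := by
  induction h with
  | dcfl h => exact good_dcfl h
  | union _ _ h1 h2 => exact good_union h1 h2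
  | concat _ _ h1 h2 => exact good_concat h1 h2
  | star _ h => exact good_star h

theorem isDCFL_empty {A : Type} : IsDCFL (∅ : Set (List A)) := by
  refine ⟨Unit, Unit, inferInstance, inferInstance,
    { transA := fun _ _ _ => none, transE := fun _ _ => none, det := by simp, init := (), Z0 := (),
      final := fun _ => false }, ?_⟩
  ext w
  constructor
  · rintro ⟨_, _, _, h⟩
    cases h
  · intro h; exact h.elim

theorem star_empty_concat {A : Type} (Y : Set (List A)) : concatL (kstarL ∅) Y = Y := by
  ext w
  constructor
  · rintro ⟨_, ⟨l, hl, rfl⟩, y, hy, rfl⟩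
    cases l with
    | nil => exact hy
    | cons u l => exact (hl u (by simp)).elim
  · intro hw
    exact ⟨[], ⟨[], by simp, rfl⟩, w, hw, rfl⟩

/-- PELs are closed under left concatenation with the regular
closure of the DCFLs, and equal the class of such products: for `X ∈ Γ_REG(DCFL)`
and a PEL `Y`, the concatenation `XY` is a PEL; conversely every PEL `Y` equals
`XY` for some `X ∈ Γ_REG(DCFL)`.  Hence `Γ_REG(DCFL) · PEL = PEL`. -/
theorem regClosure_dcfl_concat_pel {A : Type} [Finite A] :
    (∀ X Y : Set (List A), RegClosureDCFL X → IsPEL Y → IsPEL (concatL X Y)) ∧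
    (∀ Y : Set (List A), IsPEL Y →
      ∃ X : Set (List A), RegClosureDCFL X ∧ concatL X Y = Y) ∧
    {Z : Set (List A) | ∃ X Y, RegClosureDCFL X ∧ IsPEL Y ∧ Z = concatL X Y} =
      {Z : Set (List A) | IsPEL Z} := by
  have h1 : ∀ X Y : Set (List A), RegClosureDCFL X → IsPEL Y → IsPEL (concatL X Y) :=
    fun X Y hX hY => isPEL_of_good (good_of_regClosure hX) hY
  have h2 : ∀ Y : Set (List A), IsPEL Y →
      ∃ X : Set (List A), RegClosureDCFL X ∧ concatL X Y = Y :=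
    fun Y _ => ⟨kstarL ∅, .star (.dcfl isDCFL_empty), star_empty_concat Y⟩
  refine ⟨h1, h2, ?_⟩
  ext Z
  constructor
  · rintro ⟨X, Y, hX, hY, rfl⟩
    exact h1 X Y hX hY
  · intro hZ
    obtain ⟨X, hX, h⟩ := h2 Z hZ
    exact ⟨X, Z, hX, hZ, h.symm⟩
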